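/- Let Z, H, C be finite types, let (Z, H) be a pair of random variables with joint probability mass function on Z × H, and let σ : H → C be a function. If I(Z; σ(H)) = I(Z; H), then for every h ∈ H with P(H = h) > 0 and every z ∈ Z, P(Z = z | H = h) = P(Z = z | σ(H) = σ(h)). -/

import Mathlib

/-!
STATEMENT 5: If a deterministic representation `σ(H)` achieves the same mutual
information with `Z` as `H` does, then the conditional law of `Z` given `H = h`
equals its conditional law given `σ(H) = σ(h)`, for every `h` of positive probability.
-/

open Finset

/-- Marginal over the first coordinate: `p_Z(z) = ∑ h, p(z, h)`. -/
noncomputable def margFst {Z H : Type*} [Fintype H] (p : Z → H → ℝ) (z : Z) : ℝ :=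
  ∑ h, p z h

/-- Marginal over the second coordinate: `p_H(h) = ∑ z, p(z, h)`. -/
noncomputable def margSnd {Z H : Type*} [Fintype Z] (p : Z → H → ℝ) (h : H) : ℝ :=
  ∑ z, p z h

/-- Mutual information of a joint pmf on finite types. -/
noncomputable def mutualInfo {Z H : Type*} [Fintype Z] [Fintype H] (p : Z → H → ℝ) : ℝ :=
  ∑ z, ∑ h,
    if 0 < p z h then p z h * Real.log (p z h / (margFst p z * margSnd p h)) else 0

/-- The joint pmf of `(Z, σ(H))` induced by the joint pmf `p` of `(Z, H)`. -/
noncomputable def pushJoint {Z H C : Type*} [Fintype H] [DecidableEq C]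
    (p : Z → H → ℝ) (σ : H → C) (z : Z) (c : C) : ℝ :=
  ∑ h ∈ Finset.univ.filter (fun h => σ h = c), p z h

theorem sum_pushJoint_mul {Z H C : Type*} [Fintype H] [Fintype C] [DecidableEq C]
    (p : Z → H → ℝ) (σ : H → C) (z : Z) (g : C → ℝ) :
    ∑ c, pushJoint p σ z c * g c = ∑ h, p z h * g (σ h) := by
  rw [← Finset.sum_fiberwise univ σ (fun h => p z h * g (σ h))]
  refine Finset.sum_congr rfl fun c _ => ?_
  rw [pushJoint, Finset.sum_mul]
  refine Finset.sum_congr rfl fun h hh => ?_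
  rw [(Finset.mem_filter.mp hh).2]

theorem margFst_pushJoint {Z H C : Type*} [Fintype H] [Fintype C] [DecidableEq C]
    (p : Z → H → ℝ) (σ : H → C) (z : Z) :
    margFst (pushJoint p σ) z = margFst p z := by
  simpa [margFst] using sum_pushJoint_mul p σ z (fun _ => 1)

theorem pushJoint_nonneg {Z H C : Type*} [Fintype H] [DecidableEq C]
    {p : Z → H → ℝ} (σ : H → C) (hnn : ∀ z h, 0 ≤ p z h) (z : Z) (c : C) :
    0 ≤ pushJoint p σ z c :=
  Finset.sum_nonneg fun h _ => hnn z h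

theorem le_pushJoint {Z H C : Type*} [Fintype H] [DecidableEq C]
    {p : Z → H → ℝ} (σ : H → C) (hnn : ∀ z h, 0 ≤ p z h) (z : Z) (h : H) :
    p z h ≤ pushJoint p σ z (σ h) :=
  Finset.single_le_sum (f := fun h => p z h) (fun h _ => hnn z h) (by simp)

theorem margSnd_le_margSnd_pushJoint {Z H C : Type*} [Fintype Z] [Fintype H] [DecidableEq C]
    {p : Z → H → ℝ} (σ : H → C) (hnn : ∀ z h, 0 ≤ p z h) (h : H) :
    margSnd p h ≤ margSnd (pushJoint p σ) (σ h) :=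
  Finset.sum_le_sum fun z _ => le_pushJoint σ hnn z h

theorem mutualInfo_eq_sum {Z H : Type*} [Fintype Z] [Fintype H] {p : Z → H → ℝ}
    (hnn : ∀ z h, 0 ≤ p z h) :
    mutualInfo p = ∑ z, ∑ h, p z h * Real.log (p z h / (margFst p z * margSnd p h)) := by
  refine Finset.sum_congr rfl fun z _ => Finset.sum_congr rfl fun h _ => ?_
  split_ifs with hp
  · rfl
  · simp [le_antisymm (not_lt.mp hp) (hnn z h)]

theorem mutualInfo_pushJoint_eq_sum {Z H C : Type*} [Fintype Z] [Fintype H] [Fintype C]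
    [DecidableEq C] {p : Z → H → ℝ} (σ : H → C) (hnn : ∀ z h, 0 ≤ p z h) :
    mutualInfo (pushJoint p σ) = ∑ z, ∑ h, p z h *
      Real.log (pushJoint p σ z (σ h) / (margFst p z * margSnd (pushJoint p σ) (σ h))) := by
  rw [mutualInfo_eq_sum (pushJoint_nonneg σ hnn)]
  refine Finset.sum_congr rfl fun z _ => ?_
  rw [← margFst_pushJoint p σ]
  exact sum_pushJoint_mul p σ z fun c =>
    Real.log (pushJoint p σ z c / (margFst (pushJoint p σ) z * margSnd (pushJoint p σ) c))

/-- The pointwise form of the strict Gibbs inequality. -/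
theorem sub_le_mul_log_div {a b : ℝ} (ha : 0 ≤ a) (hb : 0 ≤ b) (hab : 0 < a → 0 < b) :
    a - b ≤ a * Real.log (a / b) ∧ (a - b = a * Real.log (a / b) → a = b) := by
  rcases ha.eq_or_lt with rfl | ha
  · simpa [eq_comm] using hb
  · have hb := hab ha
    have hr : 0 ≤ a / b := (div_pos ha hb).le
    have key : b * InformationTheory.klFun (a / b) = a * Real.log (a / b) + b - a := by
      rw [InformationTheory.klFun_apply]
      field_simp
    have hk := mul_nonneg hb.le (InformationTheory.klFun_nonneg hr)
    refine ⟨by linarith, fun h => ?_⟩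
    have h0 : b * InformationTheory.klFun (a / b) = 0 := by linarith
    have h1 := (InformationTheory.klFun_eq_zero_iff hr).mp
      ((mul_eq_zero.mp h0).resolve_left hb.ne')
    exact (div_eq_one_iff_eq hb.ne').mp h1

/-- Equality case of the Gibbs inequality on a finite type. -/
theorem eq_of_sum_mul_log_div_eq_zero {ι : Type*} [Fintype ι] {a b : ι → ℝ}
    (ha : ∀ i, 0 ≤ a i) (hb : ∀ i, 0 ≤ b i) (hab : ∀ i, 0 < a i → 0 < b i)
    (hsum : ∑ i, a i = ∑ i, b i) (hlog : ∑ i, a i * Real.log (a i / b i) = 0) (i : ι) :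
    a i = b i := by
  have hle := fun i => sub_le_mul_log_div (ha i) (hb i) (hab i)
  have heq : ∑ i, (a i - b i) = ∑ i, a i * Real.log (a i / b i) := by
    rw [Finset.sum_sub_distrib, hsum, hlog, sub_self]
  exact (hle i).2
    ((Finset.sum_eq_sum_iff_of_le fun i _ => (hle i).1).mp heq i (Finset.mem_univ i))

/-- If `I(Z; σ(H)) = I(Z; H)`, then `P(Z = z | H = h) = P(Z = z | σ(H) = σ(h))`
for every `h` with `P(H = h) > 0` and every `z`. -/
theorem condLaw_eq_of_mutualInfo_eq {Z H C : Type*}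
    [Fintype Z] [Fintype H] [Fintype C] [DecidableEq C]
    (p : Z → H → ℝ) (σ : H → C)
    (hnn : ∀ z h, 0 ≤ p z h) (hsum : ∑ z, ∑ h, p z h = 1)
    (hMI : mutualInfo (pushJoint p σ) = mutualInfo p) :
    ∀ h, 0 < margSnd p h → ∀ z,
      p z h / margSnd p h = pushJoint p σ z (σ h) / margSnd (pushJoint p σ) (σ h) := by
  have hS : ∀ h, 0 ≤ margSnd p h := fun h => Finset.sum_nonneg fun z _ => hnn z h
  have hpush := pushJoint_nonneg σ hnn
  have hT := margSnd_le_margSnd_pushJoint σ hnn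
  have hpS : ∀ z h, p z h ≤ margSnd p h := fun z h =>
    Finset.single_le_sum (f := fun z => p z h) (fun z _ => hnn z h) (Finset.mem_univ z)
  have hpF : ∀ z h, p z h ≤ margFst p z := fun z h =>
    Finset.single_le_sum (f := fun h => p z h) (fun h _ => hnn z h) (Finset.mem_univ h)
  have hq : ∀ h, ∑ z, pushJoint p σ z (σ h) * margSnd p h / margSnd (pushJoint p σ) (σ h)
      = margSnd p h := by
    intro h
    rw [← Finset.sum_div, ← Finset.sum_mul, ← margSnd.eq_def (pushJoint p σ)]
    rcases (hS h).eq_or_lt with h0 | h0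
    · simp [← h0]
    · exact mul_div_cancel_left₀ _ (h0.trans_le (hT h)).ne'
  have key := eq_of_sum_mul_log_div_eq_zero (ι := Z × H)
    (a := fun x => p x.1 x.2)
    (b := fun x => pushJoint p σ x.1 (σ x.2) * margSnd p x.2 / margSnd (pushJoint p σ) (σ x.2))
    (fun x => hnn _ _)
    (fun x => div_nonneg (mul_nonneg (hpush _ _) (hS _)) ((hS _).trans (hT _)))
    (fun x hx => div_pos (mul_pos (hx.trans_le (le_pushJoint σ hnn _ _))
      (hx.trans_le (hpS _ _))) (hx.trans_le ((hpS _ _).trans (hT _))))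
    (by
      rw [Fintype.sum_prod_type_right, Fintype.sum_prod_type_right]
      exact Finset.sum_congr rfl fun h _ => (hq h).symm)
    (by
      rw [mutualInfo_pushJoint_eq_sum σ hnn, mutualInfo_eq_sum hnn, eq_comm, ← sub_eq_zero,
        ← Finset.sum_sub_distrib] at hMI
      rw [← hMI, Fintype.sum_prod_type]
      refine Finset.sum_congr rfl fun z _ => ?_
      rw [← Finset.sum_sub_distrib]
      refine Finset.sum_congr rfl fun h _ => ?_
      rcases (hnn z h).eq_or_lt with h0 | h0
      · simp [← h0]
      · have h1 := h0.trans_le (hpS z h)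
        have h2 := h0.trans_le (hpF z h)
        have h3 := h1.trans_le (hT h)
        have h4 := h0.trans_le (le_pushJoint σ hnn z h)
        rw [← mul_sub, ← Real.log_div (by positivity) (by positivity)]
        congr 2
        field_simp)
  intro h hh z
  have hz := key (z, h)
  dsimp only at hz
  rw [hz]
  field_simp
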